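/- Let l > 0 and let T = {(x, y) ∈ ℝ² : 0 ≤ y ≤ x ≤ l} be the closed triangle below the diagonal of the square [0, l]². There exist constants K > 0 and δ₀ > 0 such that for every function ψ : ℝ² → ℂ that is continuously differentiable on T and every δ with 0 < δ ≤ δ₀, one has ∫₀^l |ψ(t, t)|² dt ≤ K ( (2/δ) ∬_T |ψ|² dx dy + δ ∬_T (|∂ₓψ|² + |∂_yψ|²) dx dy ). -/

import Mathlib

open MeasureTheory

/-- The closed triangle below the diagonal of the square `[0, l]²`. -/
def lowerTriangle (l : ℝ) : Set (ℝ × ℝ) := {p : ℝ × ℝ | 0 ≤ p.2 ∧ p.2 ≤ p.1 ∧ p.1 ≤ l}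

open Set in
/-- One-dimensional trace inequality at the right endpoint of an interval. -/
lemma sq_norm_right_le_integral {E : Type*} [NormedAddCommGroup E] [InnerProductSpace ℝ E]
    {a b : ℝ} (hab : a < b) {f f' : ℝ → E} {φ : ℝ → ℝ} (hf : ContinuousOn f (Icc a b))
    (hf' : ∀ x ∈ Ioo a b, HasDerivAt f (f' x) x) (hφ : IntegrableOn φ (Icc a b))
    (hle : ∀ x ∈ Ioo a b, 2 / (b - a) * ‖f x‖ ^ 2 + (b - a) * ‖f' x‖ ^ 2 ≤ φ x) :
    ‖f b‖ ^ 2 ≤ ∫ x in a..b, φ x := by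
  have hd : 0 < b - a := sub_pos.2 hab
  have key := intervalIntegral.sub_le_integral_of_hasDeriv_right_of_le
    (g := fun x => (x - a) / (b - a) * ‖f x‖ ^ 2)
    (g' := fun x => 1 / (b - a) * ‖f x‖ ^ 2 + (x - a) / (b - a) * (2 * inner ℝ (f x) (f' x)))
    (φ := φ) hab.le (by fun_prop)
    (fun x hx => ((((hasDerivAt_id x).sub_const a).div_const (b - a)).mul
      (hf' x hx).norm_sq).hasDerivWithinAt) hφ ?_
  · simpa [hd.ne'] using key
  · intro x hx
    refine le_trans ?_ (hle x hx)
    have hw0 : 0 ≤ (x - a) / (b - a) := div_nonneg (sub_nonneg.2 hx.1.le) hd.le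
    have hw1 : (x - a) / (b - a) ≤ 1 := (div_le_one hd).2 (by linarith [hx.2])
    have hn : 0 ≤ ‖f x‖ * ‖f' x‖ := by positivity
    have h1 : (x - a) / (b - a) * (2 * inner ℝ (f x) (f' x)) ≤ 2 * (‖f x‖ * ‖f' x‖) := by
      have := mul_le_mul_of_nonneg_left (real_inner_le_norm (f x) (f' x)) hw0
      have := mul_le_mul_of_nonneg_right hw1 hn
      linarith
    have h2 : 1 / (b - a) * ‖f x‖ ^ 2 + (b - a) * ‖f' x‖ ^ 2 - 2 * (‖f x‖ * ‖f' x‖)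
        = 1 / (b - a) * (‖f x‖ - (b - a) * ‖f' x‖) ^ 2 := by
      field_simp
      ring
    have h3 : 0 ≤ 1 / (b - a) * (‖f x‖ - (b - a) * ‖f' x‖) ^ 2 := by positivity
    have h4 : 2 / (b - a) * ‖f x‖ ^ 2 = 1 / (b - a) * ‖f x‖ ^ 2 + 1 / (b - a) * ‖f x‖ ^ 2 := by
      ring
    linarith

open Set in
/-- One-dimensional trace inequality at the left endpoint of an interval. -/
lemma sq_norm_left_le_integral {E : Type*} [NormedAddCommGroup E] [InnerProductSpace ℝ E]
    {a b : ℝ} (hab : a < b) {f f' : ℝ → E} {φ : ℝ → ℝ} (hf : ContinuousOn f (Icc a b))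
    (hf' : ∀ x ∈ Ioo a b, HasDerivAt f (f' x) x) (hφ : IntegrableOn φ (Icc a b))
    (hle : ∀ x ∈ Ioo a b, 2 / (b - a) * ‖f x‖ ^ 2 + (b - a) * ‖f' x‖ ^ 2 ≤ φ x) :
    ‖f a‖ ^ 2 ≤ ∫ x in a..b, φ x := by
  have hmem : ∀ x ∈ Icc (-b) (-a), -x ∈ Icc a b := fun x hx =>
    ⟨by linarith [hx.2], by linarith [hx.1]⟩
  have hmem' : ∀ x ∈ Ioo (-b) (-a), -x ∈ Ioo a b := fun x hx =>
    ⟨by linarith [hx.2], by linarith [hx.1]⟩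
  have key := sq_norm_right_le_integral (neg_lt_neg hab) (f := fun x => f (-x))
    (f' := fun x => -f' (-x)) (φ := fun x => φ (-x))
    (hf.comp continuousOn_neg hmem)
    (fun x hx => by
      simpa [Function.comp_def] using (hf' (-x) (hmem' x hx)).scomp x (hasDerivAt_neg x))
    (by
      have := hφ.comp_neg
      simpa using this)
    (fun x hx => by
      have := hle (-x) (hmem' x hx)
      rw [norm_neg, show -a - -b = b - a by ring]
      exact this)
  simpa using key

lemma isClosed_lowerTriangle (l : ℝ) : IsClosed (lowerTriangle l) :=
  (isClosed_le continuous_const continuous_snd).inter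
    ((isClosed_le continuous_snd continuous_fst).inter
      (isClosed_le continuous_fst continuous_const))

lemma isCompact_lowerTriangle (l : ℝ) : IsCompact (lowerTriangle l) := by
  refine (isCompact_Icc (a := ((0, 0) : ℝ × ℝ)) (b := (l, l))).of_isClosed_subset
    (isClosed_lowerTriangle l) ?_
  rintro ⟨x, y⟩ ⟨h0, h1, h2⟩
  simp only at h0 h1 h2
  exact ⟨⟨h0.trans h1, h0⟩, ⟨h2, h1.trans h2⟩⟩

lemma convex_lowerTriangle (l : ℝ) : Convex ℝ (lowerTriangle l) := by
  rintro ⟨x, y⟩ ⟨h0, h1, h2⟩ ⟨x', y'⟩ ⟨h0', h1', h2'⟩ a b ha hb hab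
  simp only at h0 h1 h2 h0' h1' h2'
  refine ⟨?_, ?_, ?_⟩
  · simp only [Prod.smul_mk, Prod.mk_add_mk, smul_eq_mul]
    positivity
  · simp only [Prod.smul_mk, Prod.mk_add_mk, smul_eq_mul]
    gcongr
  · simp only [Prod.smul_mk, Prod.mk_add_mk, smul_eq_mul]
    calc a * x + b * x' ≤ a * l + b * l := by gcongr
      _ = l := by rw [← add_mul, hab, one_mul]

lemma lowerTriangle_mem_nhds {l x y : ℝ} (h0 : 0 < y) (h1 : y < x) (h2 : x < l) :
    lowerTriangle l ∈ nhds (x, y) := by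
  have ho : IsOpen {p : ℝ × ℝ | 0 < p.2 ∧ p.2 < p.1 ∧ p.1 < l} :=
    (isOpen_lt continuous_const continuous_snd).inter
      ((isOpen_lt continuous_snd continuous_fst).inter
        (isOpen_lt continuous_fst continuous_const))
  exact Filter.mem_of_superset (ho.mem_nhds ⟨h0, h1, h2⟩)
    fun p hp => ⟨hp.1.le, hp.2.1.le, hp.2.2.le⟩

lemma integrableOn_sq_norm_fderiv_apply {E F : Type*} [NormedAddCommGroup E] [NormedSpace ℝ E]
    [FiniteDimensional ℝ E] [MeasurableSpace E] [BorelSpace E] [NormedAddCommGroup F]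
    [NormedSpace ℝ F] {μ : Measure E} [μ.IsAddHaarMeasure] {s : Set E}
    (hc : IsCompact s) (hconv : Convex ℝ s) (hne : (interior s).Nonempty)
    {f : E → F} (hf : ContDiffOn ℝ 1 f s) (v : E) :
    IntegrableOn (fun p => ‖fderiv ℝ f p v‖ ^ 2) s μ := by
  have hcont : ContinuousOn (fun p => ‖fderivWithin ℝ f s p v‖ ^ 2) s :=
    (((hf.continuousOn_fderivWithin (uniqueDiffOn_convex hconv hne) le_rfl).clm_apply
      continuousOn_const).norm).pow 2
  refine (hcont.integrableOn_compact hc).congr ?_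
  have hfr : ∀ᵐ p ∂μ, p ∉ frontier s := compl_mem_ae_iff.2 (hconv.addHaar_frontier μ)
  filter_upwards [ae_restrict_of_ae hfr, ae_restrict_mem hc.measurableSet] with p hp hps
  have hpi : p ∈ interior s := by
    by_contra h
    exact hp ⟨subset_closure hps, h⟩
  simp only [fderivWithin_of_mem_nhds (mem_interior_iff_mem_nhds.1 hpi)]

/-- Diagonal-trace estimate on the triangle `T = {0 ≤ y ≤ x ≤ l}`: there are
constants `K > 0` and `δ₀ > 0` such that for every `ψ` continuously differentiable
on `T` and every `0 < δ ≤ δ₀`, the `L²`-norm of the diagonal trace `ψ(t, t)` is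
controlled by the `H¹`-type data of `ψ` on `T`. -/
theorem triangle_diagonal_trace_estimate (l : ℝ) (hl : 0 < l) :
    ∃ K > (0:ℝ), ∃ δ₀ > (0:ℝ), ∀ ψ : ℝ × ℝ → ℂ,
      ContDiffOn ℝ 1 ψ (lowerTriangle l) →
      ∀ δ : ℝ, 0 < δ → δ ≤ δ₀ →
      (∫ t in (0:ℝ)..l, ‖ψ (t, t)‖ ^ 2)
        ≤ K * ((2 / δ) * (∫ p in lowerTriangle l, ‖ψ p‖ ^ 2)
          + δ * (∫ p in lowerTriangle l,
              (‖fderiv ℝ ψ p (1, 0)‖ ^ 2 + ‖fderiv ℝ ψ p (0, 1)‖ ^ 2))) := by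
  refine ⟨2, two_pos, l / 2, half_pos hl, fun ψ hψ δ hδ hδl => ?_⟩
  have hc := isCompact_lowerTriangle l
  have hne : (interior (lowerTriangle l)).Nonempty :=
    ⟨(l / 2, l / 4), mem_interior_iff_mem_nhds.2
      (lowerTriangle_mem_nhds (by linarith) (by linarith) (by linarith))⟩
  have hx := integrableOn_sq_norm_fderiv_apply (μ := volume) hc (convex_lowerTriangle l) hne hψ
    (1, 0)
  have hy := integrableOn_sq_norm_fderiv_apply (μ := volume) hc (convex_lowerTriangle l) hne hψ
    (0, 1)
  have h0 : IntegrableOn (fun p => ‖ψ p‖ ^ 2) (lowerTriangle l) :=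
    (hψ.continuousOn.norm.pow 2).integrableOn_compact hc
  set D : ℝ × ℝ → ℝ := fun p => 2 / δ * ‖ψ p‖ ^ 2 +
    δ * (‖fderiv ℝ ψ p (1, 0)‖ ^ 2 + ‖fderiv ℝ ψ p (0, 1)‖ ^ 2) with hD
  have hDint : IntegrableOn D (lowerTriangle l) :=
    (h0.const_mul _).add ((hx.add hy).const_mul _)
  have hDeq : ∫ p in lowerTriangle l, D p = (2 / δ) * (∫ p in lowerTriangle l, ‖ψ p‖ ^ 2)
      + δ * (∫ p in lowerTriangle l,
        (‖fderiv ℝ ψ p (1, 0)‖ ^ 2 + ‖fderiv ℝ ψ p (0, 1)‖ ^ 2)) := by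
    rw [← integral_const_mul, ← integral_const_mul]
    exact integral_add (h0.const_mul _) ((hx.add hy).const_mul _)
  rw [← hDeq]
  set G : ℝ × ℝ → ℝ := (lowerTriangle l).indicator D with hG
  have hG0 : ∀ p, 0 ≤ G p := Set.indicator_nonneg fun p _ => by positivity
  have hGD : ∀ {p}, p ∈ lowerTriangle l → G p = D p := fun hp => Set.indicator_of_mem hp D
  have hms := hc.measurableSet
  have hGint : Integrable G (volume.prod volume) := (integrable_indicator_iff hms).2 hDint
  have hGeq : ∫ p in lowerTriangle l, D p = ∫ p, G p ∂(volume.prod volume) :=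
    (integral_indicator hms).symm
  have hdiag : ContinuousOn (fun t : ℝ => ‖ψ (t, t)‖ ^ 2) (Set.Icc 0 l) :=
    ((hψ.continuousOn.comp (by fun_prop) fun t ht => ⟨ht.1, le_rfl, ht.2⟩).norm).pow 2
  have hint1 : IntegrableOn (fun t : ℝ => ‖ψ (t, t)‖ ^ 2) (Set.Ioo 0 (l / 2)) :=
    hdiag.integrableOn_Icc.mono_set fun t ht => ⟨ht.1.le, by linarith [ht.2]⟩
  have hint2 : IntegrableOn (fun t : ℝ => ‖ψ (t, t)‖ ^ 2) (Set.Ioo (l / 2) l) :=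
    hdiag.integrableOn_Icc.mono_set fun t ht => ⟨by linarith [ht.1], ht.2.le⟩
  have hderiv : ∀ {x y : ℝ}, 0 < y → y < x → x < l →
      HasFDerivAt ψ (fderiv ℝ ψ (x, y)) (x, y) := fun h1 h2 h3 =>
    ((hψ.contDiffAt (lowerTriangle_mem_nhds h1 h2 h3)).differentiableAt one_ne_zero).hasFDerivAt
  have first : ∫ t in (0:ℝ)..(l / 2), ‖ψ (t, t)‖ ^ 2 ≤ ∫ p in lowerTriangle l, D p := by
    rw [intervalIntegral.integral_of_le (by positivity), integral_Ioc_eq_integral_Ioo, hGeq,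
      integral_prod_symm G hGint]
    refine le_trans (setIntegral_mono_ae_restrict hint1 hGint.integral_prod_right.integrableOn ?_)
      (setIntegral_le_integral hGint.integral_prod_right
        (Filter.Eventually.of_forall fun t => integral_nonneg fun x => hG0 _))
    filter_upwards [ae_restrict_of_ae hGint.prod_left_ae, ae_restrict_mem measurableSet_Ioo]
      with t ht htm
    have hseg : ∀ x ∈ Set.Icc t (t + δ), (x, t) ∈ lowerTriangle l := fun x hx =>
      ⟨htm.1.le, hx.1, by linarith [hx.2, htm.2]⟩
    refine le_trans (sq_norm_left_le_integral (b := t + δ) (by linarith) (f := fun x => ψ (x, t))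
      (f' := fun x => fderiv ℝ ψ (x, t) (1, 0)) (φ := fun x => G (x, t))
      (hψ.continuousOn.comp (by fun_prop) hseg) (fun x hx => ?_) ht.integrableOn
      fun x hx => ?_) ?_
    · exact (hderiv htm.1 hx.1 (by linarith [hx.2, htm.2])).comp_hasDerivAt x
        ((hasDerivAt_id x).prodMk (hasDerivAt_const x t))
    · rw [hGD (hseg x (Set.Ioo_subset_Icc_self hx)), hD, add_sub_cancel_left]
      have : 0 ≤ δ * ‖fderiv ℝ ψ (x, t) (0, 1)‖ ^ 2 := by positivity
      simp only
      linarith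
    · rw [intervalIntegral.integral_of_le (by linarith)]
      exact setIntegral_le_integral ht (Filter.Eventually.of_forall fun x => hG0 _)
  have second : ∫ t in (l / 2)..l, ‖ψ (t, t)‖ ^ 2 ≤ ∫ p in lowerTriangle l, D p := by
    rw [intervalIntegral.integral_of_le (by linarith), integral_Ioc_eq_integral_Ioo, hGeq,
      integral_prod G hGint]
    refine le_trans (setIntegral_mono_ae_restrict hint2 hGint.integral_prod_left.integrableOn ?_)
      (setIntegral_le_integral hGint.integral_prod_left
        (Filter.Eventually.of_forall fun t => integral_nonneg fun x => hG0 _))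
    filter_upwards [ae_restrict_of_ae hGint.prod_right_ae, ae_restrict_mem measurableSet_Ioo]
      with t ht htm
    have hseg : ∀ y ∈ Set.Icc (t - δ) t, (t, y) ∈ lowerTriangle l := fun y hy =>
      ⟨by linarith [hy.1, htm.1], hy.2, htm.2.le⟩
    refine le_trans (sq_norm_right_le_integral (a := t - δ) (by linarith) (f := fun y => ψ (t, y))
      (f' := fun y => fderiv ℝ ψ (t, y) (0, 1)) (φ := fun y => G (t, y))
      (hψ.continuousOn.comp (by fun_prop) hseg) (fun y hy => ?_) ht.integrableOn
      fun y hy => ?_) ?_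
    · exact (hderiv (by linarith [hy.1, htm.1]) hy.2 htm.2).comp_hasDerivAt y
        ((hasDerivAt_const y t).prodMk (hasDerivAt_id y))
    · rw [hGD (hseg y (Set.Ioo_subset_Icc_self hy)), hD, sub_sub_cancel]
      have : 0 ≤ δ * ‖fderiv ℝ ψ (t, y) (1, 0)‖ ^ 2 := by positivity
      simp only
      linarith
    · rw [intervalIntegral.integral_of_le (by linarith)]
      exact setIntegral_le_integral ht (Filter.Eventually.of_forall fun x => hG0 _)
  rw [← intervalIntegral.integral_add_adjacent_intervals (b := l / 2)
    ((intervalIntegrable_iff_integrableOn_Ioo_of_le (by linarith)).2 hint1)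
    ((intervalIntegrable_iff_integrableOn_Ioo_of_le (by linarith)).2 hint2)]
  linarith
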